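/- For every integer k ≥ 1, q_{k+2} = (2(k²+1)/(k(k+1)))·q_k + (2(k²−2k−1)/(k²(k+1)²))·p_k. -/

import Mathlib

open MeasureTheory

/-- The cubic NLS soliton profile. -/
noncomputable def Q (y : ℝ) : ℝ := Real.sqrt 2 / Real.cosh y

/-- `p k = ∫ Q^k cos`. -/
noncomputable def p (k : ℕ) : ℝ := ∫ y : ℝ, (Q y) ^ k * Real.cos y

/-- `q k = ∫ Q^k ln Q cos`. -/
noncomputable def q (k : ℕ) : ℝ := ∫ y : ℝ, (Q y) ^ k * Real.log (Q y) * Real.cos y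

theorem Q_pos (y : ℝ) : 0 < Q y :=
  div_pos (by positivity) (Real.cosh_pos y)

theorem continuous_Q : Continuous Q :=
  continuous_const.div Real.continuous_cosh fun y => (Real.cosh_pos y).ne'

theorem continuous_log_Q : Continuous fun y => Real.log (Q y) :=
  continuous_Q.log fun y => (Q_pos y).ne'

theorem continuous_tanh_real : Continuous Real.tanh := by
  rw [funext Real.tanh_eq_sinh_div_cosh]
  exact Real.continuous_sinh.div₀ Real.continuous_cosh fun y => (Real.cosh_pos y).ne'

theorem tanh_sq_eq_one_sub_Q_sq (y : ℝ) : Real.tanh y ^ 2 = 1 - Q y ^ 2 / 2 := by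
  have h := Real.cosh_sq y
  have hc := (Real.cosh_pos y).ne'
  rw [Q, Real.tanh_eq_sinh_div_cosh, div_pow, div_pow, Real.sq_sqrt zero_le_two]
  field_simp
  linarith

theorem hasDerivAt_tanh_real (y : ℝ) : HasDerivAt Real.tanh (Q y ^ 2 / 2) y := by
  have hc := (Real.cosh_pos y).ne'
  rw [funext Real.tanh_eq_sinh_div_cosh]
  refine ((Real.hasDerivAt_sinh y).div (Real.hasDerivAt_cosh y) hc).congr_deriv ?_
  rw [Q, div_pow, Real.sq_sqrt zero_le_two]
  have := Real.cosh_sq y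
  field_simp
  linarith

theorem hasDerivAt_Q (y : ℝ) : HasDerivAt Q (-(Real.tanh y * Q y)) y := by
  have hc := (Real.cosh_pos y).ne'
  have h := (hasDerivAt_const y (Real.sqrt 2)).div (Real.hasDerivAt_cosh y) hc
  refine h.congr_deriv ?_
  rw [Q, Real.tanh_eq_sinh_div_cosh]
  field_simp
  ring

theorem hasDerivAt_log_Q (y : ℝ) :
    HasDerivAt (fun x => Real.log (Q x)) (-Real.tanh y) y := by
  refine ((hasDerivAt_Q y).log (Q_pos y).ne').congr_deriv ?_
  have := (Q_pos y).ne'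
  field_simp

theorem hasDerivAt_Q_pow (k : ℕ) (y : ℝ) :
    HasDerivAt (fun x => Q x ^ k) (-(k * Real.tanh y * Q y ^ k)) y := by
  refine ((hasDerivAt_Q y).pow k).congr_deriv ?_
  rcases k with _ | n
  · simp
  · rw [Nat.add_sub_cancel, pow_succ]
    ring

theorem Q_le_two (y : ℝ) : Q y ≤ 2 := by
  have hs : Real.sqrt 2 ≤ 2 := Real.sqrt_le_iff.2 (by norm_num)
  rw [Q, div_le_iff₀ (Real.cosh_pos y)]
  linarith [Real.one_le_cosh y]

theorem Q_le_exp_neg_abs (y : ℝ) : Q y ≤ 4 * Real.exp (-|y|) := by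
  have hs : Real.sqrt 2 ≤ 2 := Real.sqrt_le_iff.2 (by norm_num)
  have hc : Real.exp |y| ≤ 2 * Real.cosh y := by
    rw [← Real.cosh_abs, Real.cosh_eq]
    linarith [Real.exp_pos (-|y|)]
  have he : Real.exp (-|y|) * Real.exp |y| = 1 := by
    rw [← Real.exp_add, neg_add_cancel, Real.exp_zero]
  rw [Q, div_le_iff₀ (Real.cosh_pos y)]
  nlinarith [mul_le_mul_of_nonneg_left hc (Real.exp_pos (-|y|)).le]

theorem abs_log_Q_le (y : ℝ) : |Real.log (Q y)| ≤ 1 + |y| := by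
  have hc : Real.cosh y ≤ Real.exp |y| := by
    rw [← Real.cosh_abs, Real.cosh_eq]
    have : Real.exp (-|y|) ≤ Real.exp |y| :=
      Real.exp_le_exp.2 (by linarith [abs_nonneg y])
    linarith
  have hlc : Real.log (Real.cosh y) ≤ |y| :=
    (Real.log_le_iff_le_exp (Real.cosh_pos y)).2 hc
  have hlc0 : 0 ≤ Real.log (Real.cosh y) := Real.log_nonneg (Real.one_le_cosh y)
  have hs : Real.log (Real.sqrt 2) ≤ 1 := by
    have hs2 : Real.sqrt 2 ≤ 2 := Real.sqrt_le_iff.2 (by norm_num)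
    linarith [Real.log_le_sub_one_of_pos (show 0 < Real.sqrt 2 by positivity)]
  have hs0 : 0 ≤ Real.log (Real.sqrt 2) := Real.log_nonneg (Real.one_le_sqrt.2 (by norm_num))
  rw [Q, Real.log_div (by positivity) (Real.cosh_pos y).ne', abs_le]
  constructor <;> linarith [abs_nonneg y]

theorem integrable_exp_neg_abs_div_two : Integrable fun y : ℝ => Real.exp (-|y| / 2) := by
  rw [← integrableOn_univ, ← Set.Iic_union_Ioi (a := (0 : ℝ))]
  refine IntegrableOn.union ?_ ?_
  · refine (integrableOn_exp_mul_Iic (a := 1 / 2) (by norm_num) 0).congr_fun (fun y hy => ?_)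
      measurableSet_Iic
    simp only [abs_of_nonpos (Set.mem_Iic.1 hy)]
    ring_nf
  · refine (integrableOn_exp_mul_Ioi (a := -1 / 2) (by norm_num) 0).congr_fun (fun y hy => ?_)
      measurableSet_Ioi
    simp only [abs_of_pos (Set.mem_Ioi.1 hy)]
    ring_nf

theorem Q_mul_one_add_abs_le (y : ℝ) : Q y * (1 + |y|) ≤ 8 * Real.exp (-|y| / 2) := by
  have h1 : 1 + |y| ≤ 2 * Real.exp (|y| / 2) := by
    linarith [Real.add_one_le_exp (|y| / 2), abs_nonneg y]
  calc Q y * (1 + |y|) ≤ 4 * Real.exp (-|y|) * (2 * Real.exp (|y| / 2)) :=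
        mul_le_mul (Q_le_exp_neg_abs y) h1 (by positivity) (by positivity)
    _ = 8 * (Real.exp (-|y|) * Real.exp (|y| / 2)) := by ring
    _ = 8 * Real.exp (-|y| / 2) := by rw [← Real.exp_add]; ring_nf

theorem integrable_Q_pow_mul {k : ℕ} (hk : 1 ≤ k) {g : ℝ → ℝ} (hg : Continuous g)
    (hb : ∀ y, |g y| ≤ 1 + |y|) : Integrable fun y => Q y ^ k * g y := by
  obtain ⟨n, rfl⟩ := Nat.exists_eq_add_of_le' hk
  refine (integrable_exp_neg_abs_div_two.const_mul (2 ^ n * 8)).mono'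
    ((continuous_Q.pow _).mul hg).aestronglyMeasurable (.of_forall fun y => ?_)
  have hQ := Q_pos y
  rw [Real.norm_eq_abs, abs_mul, abs_of_pos (pow_pos hQ _), pow_succ, mul_assoc, mul_assoc]
  refine mul_le_mul (pow_le_pow_left₀ hQ.le (Q_le_two y) n) ?_ (by positivity) (by positivity)
  exact (mul_le_mul_of_nonneg_left (hb y) hQ.le).trans (Q_mul_one_add_abs_le y)

theorem integrable_Q_pow_mul_of_le_one {k : ℕ} (hk : 1 ≤ k) {g : ℝ → ℝ} (hg : Continuous g)
    (hb : ∀ y, |g y| ≤ 1) : Integrable fun y => Q y ^ k * g y :=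
  integrable_Q_pow_mul hk hg fun y => (hb y).trans (by linarith [abs_nonneg y])

theorem integrable_Q_pow_mul_log_mul {k : ℕ} (hk : 1 ≤ k) {g : ℝ → ℝ} (hg : Continuous g)
    (hb : ∀ y, |g y| ≤ 1) : Integrable fun y => Q y ^ k * Real.log (Q y) * g y := by
  simp only [mul_assoc]
  refine integrable_Q_pow_mul hk (continuous_log_Q.mul hg) fun y => ?_
  rw [abs_mul]
  exact (mul_le_of_le_one_right (abs_nonneg _) (hb y)).trans (abs_log_Q_le y)

theorem continuous_tanh_mul_cos : Continuous fun y => Real.tanh y * Real.cos y :=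
  continuous_tanh_real.mul Real.continuous_cos

theorem abs_tanh_mul_cos_le_one (y : ℝ) : |Real.tanh y * Real.cos y| ≤ 1 := by
  rw [abs_mul]
  exact mul_le_one₀ (Real.abs_tanh_lt_one y).le (abs_nonneg _) (Real.abs_cos_le_one y)

theorem p_add_two {k : ℕ} (hk : 1 ≤ k) :
    (k : ℝ) * (k + 1) / 2 * p (k + 2) = ((k : ℝ) ^ 2 + 1) * p k := by
  have h0 : Integrable fun y => Q y ^ k * Real.cos y :=
    integrable_Q_pow_mul_of_le_one hk Real.continuous_cos Real.abs_cos_le_one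
  have h2 : Integrable fun y => Q y ^ (k + 2) * Real.cos y :=
    integrable_Q_pow_mul_of_le_one (by omega) Real.continuous_cos Real.abs_cos_le_one
  have hF : Integrable fun y => Q y ^ k * Real.sin y
      - k * (Q y ^ k * (Real.tanh y * Real.cos y)) :=
    (integrable_Q_pow_mul_of_le_one hk Real.continuous_sin Real.abs_sin_le_one).sub
      ((integrable_Q_pow_mul_of_le_one hk continuous_tanh_mul_cos
        abs_tanh_mul_cos_le_one).const_mul _)
  have h := integral_eq_zero_of_hasDerivAt_of_integrable
    (f' := fun y => ((k : ℝ) ^ 2 + 1) * (Q y ^ k * Real.cos y)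
      - (k : ℝ) * (k + 1) / 2 * (Q y ^ (k + 2) * Real.cos y))
    (fun y => ?_) ((h0.const_mul _).sub (h2.const_mul _)) hF
  · rw [integral_sub (h0.const_mul _) (h2.const_mul _), integral_const_mul,
      integral_const_mul] at h
    unfold p
    linarith
  · refine (((hasDerivAt_Q_pow k y).mul (Real.hasDerivAt_sin y)).sub
      (((hasDerivAt_Q_pow k y).mul ((hasDerivAt_tanh_real y).mul
        (Real.hasDerivAt_cos y))).const_mul (k : ℝ))).congr_deriv ?_
    simp only [Pi.mul_apply]
    linear_combination (k : ℝ) ^ 2 * Q y ^ k * Real.cos y * tanh_sq_eq_one_sub_Q_sq y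

theorem q_add_two_eq_add_p {k : ℕ} (hk : 1 ≤ k) :
    (k : ℝ) * (k + 1) / 2 * q (k + 2) =
      ((k : ℝ) ^ 2 + 1) * q k + 2 * k * p k - (2 * k + 1) / 2 * p (k + 2) := by
  have hp0 : Integrable fun y => Q y ^ k * Real.cos y :=
    integrable_Q_pow_mul_of_le_one hk Real.continuous_cos Real.abs_cos_le_one
  have hp2 : Integrable fun y => Q y ^ (k + 2) * Real.cos y :=
    integrable_Q_pow_mul_of_le_one (by omega) Real.continuous_cos Real.abs_cos_le_one
  have hq0 : Integrable fun y => Q y ^ k * Real.log (Q y) * Real.cos y :=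
    integrable_Q_pow_mul_log_mul hk Real.continuous_cos Real.abs_cos_le_one
  have hq2 : Integrable fun y => Q y ^ (k + 2) * Real.log (Q y) * Real.cos y :=
    integrable_Q_pow_mul_log_mul (by omega) Real.continuous_cos Real.abs_cos_le_one
  have hF : Integrable fun y => Q y ^ k * Real.log (Q y) * Real.sin y
      - k * (Q y ^ k * Real.log (Q y) * (Real.tanh y * Real.cos y))
      - Q y ^ k * (Real.tanh y * Real.cos y) :=
    ((integrable_Q_pow_mul_log_mul hk Real.continuous_sin Real.abs_sin_le_one).sub
      ((integrable_Q_pow_mul_log_mul hk continuous_tanh_mul_cos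
        abs_tanh_mul_cos_le_one).const_mul _)).sub
      (integrable_Q_pow_mul_of_le_one hk continuous_tanh_mul_cos abs_tanh_mul_cos_le_one)
  have hq := (hq0.const_mul ((k : ℝ) ^ 2 + 1)).sub (hq2.const_mul ((k : ℝ) * (k + 1) / 2))
  have hp := (hp0.const_mul (2 * (k : ℝ))).sub (hp2.const_mul ((2 * (k : ℝ) + 1) / 2))
  have h := integral_eq_zero_of_hasDerivAt_of_integrable (fun y => ?_) (hq.add hp) hF
  · rw [integral_add' hq hp, integral_sub' (hq0.const_mul _) (hq2.const_mul _),
      integral_sub' (hp0.const_mul _) (hp2.const_mul _)] at h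
    simp only [integral_const_mul] at h
    unfold p q
    linarith
  · have hQL := (hasDerivAt_Q_pow k y).mul (hasDerivAt_log_Q y)
    have ht := (hasDerivAt_tanh_real y).mul (Real.hasDerivAt_cos y)
    refine (((hQL.mul (Real.hasDerivAt_sin y)).sub ((hQL.mul ht).const_mul (k : ℝ))).sub
      ((hasDerivAt_Q_pow k y).mul ht)).congr_deriv ?_
    simp only [Pi.add_apply, Pi.sub_apply, Pi.mul_apply]
    linear_combination ((k : ℝ) ^ 2 * Real.log (Q y) + 2 * k) * Q y ^ k * Real.cos y
      * tanh_sq_eq_one_sub_Q_sq y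

theorem stmt12 :
    ∀ k : ℕ, 1 ≤ k →
      q (k + 2) = (2 * ((k : ℝ) ^ 2 + 1) / ((k : ℝ) * ((k : ℝ) + 1))) * q k
        + (2 * ((k : ℝ) ^ 2 - 2 * (k : ℝ) - 1) / ((k : ℝ) ^ 2 * ((k : ℝ) + 1) ^ 2)) * p k := by
  intro k hk
  have hk0 : (0 : ℝ) < k := by exact_mod_cast hk
  have hp := p_add_two hk
  have hq := q_add_two_eq_add_p hk
  have hp' : p (k + 2) = 2 * ((k : ℝ) ^ 2 + 1) / (k * (k + 1)) * p k := by
    field_simp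
    linarith
  rw [hp'] at hq
  have hq' : q (k + 2) = 2 / ((k : ℝ) * (k + 1)) * (k * (k + 1) / 2 * q (k + 2)) := by
    field_simp
  rw [hq', hq]
  field_simp
  ring
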